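/- Suppose w is a positive weight on the unit circle satisfying the implication: there exists β > 0 such that |ψ^{-1}(E)|/|ψ^{-1}(I)| < β implies |E|/|I| < 1/2 for all arcs I and measurable E ⊂ I, where ψ is a homeomorphism of the circle with ψ^{-1} absolutely continuous and |(ψ^{-1})′| ∈ A∞. Then (under the Coifman–Fefferman A∞ framework) |ψ′| ∈ A∞ as well; i.e., the inverse of a circle homeomorphism whose derivative is an A∞ weight also has derivative an A∞ weight. -/

import Mathlib

open MeasureTheory Set
open scoped ENNReal

instance : Fact ((0:ℝ) < 2 * Real.pi) := ⟨by positivity⟩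

/-- The unit circle, modeled as `ℝ / 2πℤ` with its arclength (Haar) measure. -/
abbrev Circle2pi := AddCircle (2 * Real.pi)

/-- An arc of the circle: the image of an interval `(a, b]` of length at most `2π`. -/
def IsArc (I : Set Circle2pi) : Prop :=
  ∃ a b : ℝ, a < b ∧ b ≤ a + 2 * Real.pi ∧
    I = (fun x : ℝ => (x : Circle2pi)) '' Set.Ioc a b

/-- The Coifman–Fefferman `A∞` condition (2a) for the "derivative" of a circle
homeomorphism `ψ`, expressed measure-theoretically: `|ψ(E)| = ∫_E |ψ′|`, so
`A∞` of `|ψ′|` says `|ψ(E)|/|ψ(I)| < β ⟹ |E|/|I| < 1/2`. -/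
def DerivAinfty (ψ : Circle2pi → Circle2pi) : Prop :=
  ∃ β > (0:ℝ), ∀ I E : Set Circle2pi, IsArc I → E ⊆ I → MeasurableSet E →
    (volume (ψ '' E)).toReal / (volume (ψ '' I)).toReal < β →
    (volume E).toReal / (volume I).toReal < 1 / 2

/-- Finite unions of dyadic subintervals of `(a, b]`. -/
inductive Dy : ℝ → ℝ → Set ℝ → Prop
  | empty (a b : ℝ) : Dy a b ∅
  | full (a b : ℝ) : Dy a b (Ioc a b)
  | split (a b : ℝ) (S T : Set ℝ) : Dy a ((a+b)/2) S → Dy ((a+b)/2) b T → Dy a b (S ∪ T)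

theorem Dy.subset {a b : ℝ} {F : Set ℝ} (h : Dy a b F) : a ≤ b → F ⊆ Ioc a b := by
  induction h with
  | empty a b => intro _; exact empty_subset _
  | full a b => intro _; exact Subset.rfl
  | split a b S T _ _ ihS ihT =>
    intro hab
    refine union_subset ((ihS (by linarith)).trans ?_) ((ihT (by linarith)).trans ?_)
    · exact Ioc_subset_Ioc le_rfl (by linarith)
    · exact Ioc_subset_Ioc (by linarith) le_rfl

theorem Dy.meas {a b : ℝ} {F : Set ℝ} (h : Dy a b F) : MeasurableSet F := by
  induction h with
  | empty a b => exact MeasurableSet.empty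
  | full a b => exact measurableSet_Ioc
  | split a b S T _ _ ihS ihT => exact ihS.union ihT

theorem Dy.vol_ne_top {a b : ℝ} {F : Set ℝ} (h : Dy a b F) (hab : a ≤ b) : volume F ≠ ⊤ :=
  ((measure_mono (h.subset hab)).trans_lt measure_Ioc_lt_top).ne

def Good (ν : Measure ℝ) (γ A B : ℝ) : Prop :=
  ∀ a b : ℝ, A ≤ a → a < b → b ≤ B → ∀ E : Set ℝ, E ⊆ Ioc a b → MeasurableSet E →
    volume.real E ≤ (b - a) / 2 → ν.real E ≤ γ * ν.real (Ioc a b)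

theorem dy_step (ν : Measure ℝ) [IsFiniteMeasure ν] (γ A B : ℝ) (hG : Good ν γ A B)
    {a b : ℝ} {F : Set ℝ} (h : Dy a b F) : A ≤ a → a < b → b ≤ B →
    volume.real F ≤ (b - a) / 4 →
    ∃ F₁, Dy a b F₁ ∧ volume.real F₁ ≤ 4 * volume.real F ∧ ν.real F ≤ γ * ν.real F₁ := by
  induction h with
  | empty a b => 
    intro _ _ _ _
    exact ⟨∅, Dy.empty a b, by simp, by simp⟩
  | full a b =>
    intro _ hab _ h
    rw [Real.volume_real_Ioc_of_le hab.le] at h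
    linarith
  | split a b S T hS hT ihS ihT =>
    intro hA hab hB h
    have hfin : volume (S ∪ T) ≠ ⊤ := (Dy.split a b S T hS hT).vol_ne_top hab.le
    have h1 : volume.real S ≤ volume.real (S ∪ T) := measureReal_mono subset_union_left hfin
    have h2 : volume.real T ≤ volume.real (S ∪ T) := measureReal_mono subset_union_right hfin
    have hdisj : Disjoint (Ioc a ((a+b)/2)) (Ioc ((a+b)/2) b) := by
      rw [Set.disjoint_left]; intro x hx hx'; exact absurd hx.2 (not_le.2 hx'.1)
    have eS : ∃ F₁, Dy a ((a+b)/2) F₁ ∧ volume.real F₁ ≤ 4 * volume.real S ∧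
        ν.real S ≤ γ * ν.real F₁ := by
      by_cases hc : volume.real S ≤ ((a+b)/2 - a) / 4
      · exact ihS hA (by linarith) (by linarith) hc
      · refine ⟨_, Dy.full _ _, ?_, ?_⟩
        · rw [Real.volume_real_Ioc_of_le (by linarith)]; linarith
        · exact hG _ _ hA (by linarith) (by linarith) S (hS.subset (by linarith)) hS.meas
            (by linarith)
    have eT : ∃ F₁, Dy ((a+b)/2) b F₁ ∧ volume.real F₁ ≤ 4 * volume.real T ∧
        ν.real T ≤ γ * ν.real F₁ := by
      by_cases hc : volume.real T ≤ (b - (a+b)/2) / 4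
      · exact ihT (by linarith) (by linarith) (by linarith) hc
      · refine ⟨_, Dy.full _ _, ?_, ?_⟩
        · rw [Real.volume_real_Ioc_of_le (by linarith)]; linarith
        · exact hG _ _ (by linarith) (by linarith) (by linarith) T (hT.subset (by linarith)) hT.meas
            (by linarith)
    obtain ⟨S₁, dS, vS, nS⟩ := eS
    obtain ⟨T₁, dT, vT, nT⟩ := eT
    have d0 : Disjoint S T := hdisj.mono (hS.subset (by linarith)) (hT.subset (by linarith))
    have d1 : Disjoint S₁ T₁ := hdisj.mono (dS.subset (by linarith)) (dT.subset (by linarith))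
    refine ⟨S₁ ∪ T₁, Dy.split a b _ _ dS dT, ?_, ?_⟩
    · rw [measureReal_union d0 hT.meas (hS.vol_ne_top (by linarith)) (hT.vol_ne_top (by linarith))]
      have := measureReal_union_le (μ := volume) S₁ T₁
      linarith
    · rw [measureReal_union d1 dT.meas]
      have := measureReal_union_le (μ := ν) S T
      linarith

theorem dy_iter (ν : Measure ℝ) [IsFiniteMeasure ν] (γ A B : ℝ) (hG : Good ν γ A B)
    (hγ : 0 ≤ γ) (hAB : A < B) (n : ℕ) : ∀ F, Dy A B F → volume.real F ≤ (B - A) / 4 ^ n →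
    ν.real F ≤ γ ^ n * ν.real (Ioc A B) := by
  induction n with
  | zero =>
    intro F hF _
    simpa using measureReal_mono (μ := ν) (hF.subset hAB.le)
  | succ n ih =>
    intro F hF h
    have hp : (1:ℝ) ≤ 4 ^ n := one_le_pow₀ (by norm_num)
    have h4 : (B - A) / 4 ^ (n+1) = (B - A) / 4 ^ n / 4 := by
      rw [pow_succ, div_div]
    have hle : (B - A) / 4 ^ n ≤ B - A := div_le_self (by linarith) hp
    obtain ⟨F₁, d, v, m⟩ := dy_step ν γ A B hG hF le_rfl hAB le_rfl (by linarith)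
    have := ih F₁ d (by linarith)
    calc ν.real F ≤ γ * ν.real F₁ := m
      _ ≤ γ * (γ ^ n * ν.real (Ioc A B)) := by gcongr
      _ = _ := by ring

open Classical in
noncomputable def GG (U : Set ℝ) : ℕ → ℝ → ℝ → Set ℝ
  | 0, a, b => if Ioc a b ⊆ U then Ioc a b else ∅
  | n+1, a, b => if Ioc a b ⊆ U then Ioc a b else GG U n a ((a+b)/2) ∪ GG U n ((a+b)/2) b

theorem GG_dy (U : Set ℝ) (n : ℕ) : ∀ a b, Dy a b (GG U n a b) := by
  induction n with
  | zero => intro a b; rw [GG]; split_ifs; exacts [Dy.full _ _, Dy.empty _ _]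
  | succ n ih => intro a b; rw [GG]; split_ifs; exacts [Dy.full _ _, Dy.split _ _ _ _ (ih _ _) (ih _ _)]

theorem GG_sub (U : Set ℝ) (n : ℕ) : ∀ a b, GG U n a b ⊆ U := by
  induction n with
  | zero => intro a b; rw [GG]; split_ifs with h; exacts [h, empty_subset _]
  | succ n ih => intro a b; rw [GG]; split_ifs with h; exacts [h, union_subset (ih _ _) (ih _ _)]

theorem GG_mono (U : Set ℝ) (n : ℕ) : ∀ a b, GG U n a b ⊆ GG U (n+1) a b := by
  induction n with
  | zero => intro a b; rw [GG, GG]; split_ifs with h; exacts [Subset.rfl, empty_subset _]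
  | succ n ih =>
    intro a b; rw [GG, GG]; split_ifs with h
    exacts [Subset.rfl, union_subset_union (ih _ _) (ih _ _)]

theorem GG_mem (U : Set ℝ) (x ε : ℝ) (hU : Metric.ball x ε ⊆ U) (n : ℕ) :
    ∀ a b, x ∈ Ioc a b → (b - a) / 2 ^ n < ε → x ∈ GG U n a b := by
  have key : ∀ a b, x ∈ Ioc a b → b - a < ε → Ioc a b ⊆ U := by
    intro a b hx h y hy
    apply hU
    rw [Metric.mem_ball, Real.dist_eq, abs_lt]
    constructor <;> linarith [hx.1, hx.2, hy.1, hy.2]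
  induction n with
  | zero => 
    intro a b hx h
    rw [GG, if_pos (key a b hx (by simpa using h))]; exact hx
  | succ n ih =>
    intro a b hx h
    rw [GG]
    split_ifs with hs
    · exact hx
    · have e : (b - a) / 2 ^ (n+1) = ((b - a) / 2) / 2 ^ n := by
        rw [pow_succ', div_div]
      rw [e] at h
      by_cases hm : x ≤ (a+b)/2
      · left; exact ih _ _ ⟨hx.1, hm⟩ (by convert h using 2; ring)
      · right; exact ih _ _ ⟨not_le.1 hm, hx.2⟩ (by convert h using 2; ring)

theorem real_main (ν : Measure ℝ) [IsFiniteMeasure ν] (γ A B : ℝ) (hG : Good ν γ A B)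
    (hγ : 0 ≤ γ) (hAB : A < B) (n : ℕ) (E : Set ℝ) (hE : E ⊆ Ioc A B)
    (hv : volume.real E < (B - A) / 4 ^ n) : ν.real E ≤ γ ^ n * ν.real (Ioc A B) := by
  have hfin : volume E ≠ ⊤ := ((measure_mono hE).trans_lt measure_Ioc_lt_top).ne
  have hv' : volume E < ENNReal.ofReal ((B - A) / 4 ^ n) := by
    rw [ENNReal.lt_ofReal_iff_toReal_lt hfin]; exact hv
  obtain ⟨U, hEU, hUo, hUv⟩ := Set.exists_isOpen_lt_of_lt E _ hv'
  have hUfin : volume U ≠ ⊤ := (hUv.trans ENNReal.ofReal_lt_top).ne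
  have hUr : volume.real U < (B - A) / 4 ^ n := by
    rw [ENNReal.lt_ofReal_iff_toReal_lt hUfin] at hUv; exact hUv
  have hmono : Monotone (fun k => GG U k A B) := monotone_nat_of_le_succ (fun k => GG_mono U k A B)
  have hsub : E ⊆ ⋃ k, GG U k A B := by
    intro x hx
    obtain ⟨ε, hε, hb⟩ := Metric.isOpen_iff.1 hUo x (hEU hx)
    obtain ⟨k, hk⟩ := exists_pow_lt_of_lt_one (div_pos hε (sub_pos.2 hAB)) (by norm_num : (1/2:ℝ) < 1)
    rw [mem_iUnion]
    refine ⟨k, GG_mem U x ε hb k A B (hE hx) ?_⟩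
    rw [lt_div_iff₀ (sub_pos.2 hAB)] at hk
    rw [one_div, inv_pow] at hk
    rw [div_eq_inv_mul]; exact hk
  have hb : ∀ k, ν.real (GG U k A B) ≤ γ ^ n * ν.real (Ioc A B) := fun k =>
    dy_iter ν γ A B hG hγ hAB n _ (GG_dy U k A B)
      ((measureReal_mono (GG_sub U k A B) hUfin).trans hUr.le)
  have hlim : ν (⋃ k, GG U k A B) ≤ ENNReal.ofReal (γ ^ n * ν.real (Ioc A B)) := by
    rw [hmono.measure_iUnion]
    refine iSup_le fun k => ?_
    rw [← ofReal_measureReal (measure_ne_top _ _)]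
    exact ENNReal.ofReal_le_ofReal (hb k)
  have h := (measure_mono hsub).trans hlim
  exact ENNReal.toReal_le_of_le_ofReal (by positivity) h


theorem preim_eq (A : ℝ) (E : Set ℝ) (hE : E ⊆ Ioc A (A + 2 * Real.pi)) :
    (fun x : Circle2pi => ((AddCircle.equivIoc (2 * Real.pi) A x : Ioc A (A + 2 * Real.pi)) : ℝ)) ⁻¹' E
      = (fun x : ℝ => (x : Circle2pi)) '' E := by
  ext x
  constructor
  · intro hx
    exact ⟨_, hx, AddCircle.coe_equivIoc⟩
  · rintro ⟨y, hy, rfl⟩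
    simp only [mem_preimage]
    rw [AddCircle.equivIoc_coe_of_mem (hE hy)]
    exact hy

theorem meas_f (A : ℝ) : Measurable
    (fun x : Circle2pi => ((AddCircle.equivIoc (2 * Real.pi) A x : Ioc A (A + 2 * Real.pi)) : ℝ)) :=
  measurable_subtype_coe.comp (AddCircle.measurableEquivIoc (2 * Real.pi) A).measurable

theorem meas_im (A : ℝ) (E : Set ℝ) (hE : E ⊆ Ioc A (A + 2 * Real.pi)) (hm : MeasurableSet E) :
    MeasurableSet ((fun x : ℝ => (x : Circle2pi)) '' E) := by
  rw [← preim_eq A E hE]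
  exact meas_f A hm

theorem vol_im (A : ℝ) (E : Set ℝ) (hE : E ⊆ Ioc A (A + 2 * Real.pi)) (hm : MeasurableSet E) :
    volume ((fun x : ℝ => (x : Circle2pi)) '' E) = volume E := by
  rw [AddCircle.add_projection_respects_measure (2 * Real.pi) A (meas_im A E hE hm)]
  congr 1
  ext x
  constructor
  · rintro ⟨⟨y, hy, hyx⟩, hx⟩
    have : y = x := (AddCircle.coe_eq_coe_iff_of_mem_Ioc (hE hy) hx).1 hyx
    exact this ▸ hy
  · intro hx
    exact ⟨⟨x, hx, rfl⟩, hE hx⟩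

theorem volr_arc (a b : ℝ) (hab : a < b) (hb : b ≤ a + 2 * Real.pi) :
    volume.real ((fun x : ℝ => (x : Circle2pi)) '' Ioc a b) = b - a := by
  rw [measureReal_def, vol_im a _ (Ioc_subset_Ioc le_rfl hb) measurableSet_Ioc, ← measureReal_def,
    Real.volume_real_Ioc_of_le hab.le]

theorem circle_main (μ : Measure Circle2pi) [IsFiniteMeasure μ] (γ : ℝ) (hγ : 0 ≤ γ)
    (H : ∀ K E : Set Circle2pi, IsArc K → E ⊆ K → MeasurableSet E →
      volume.real E ≤ volume.real K / 2 → μ.real E ≤ γ * μ.real K)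
    (A B : ℝ) (hAB : A < B) (hB : B ≤ A + 2 * Real.pi) (n : ℕ) (F : Set Circle2pi)
    (hF : F ⊆ (fun x : ℝ => (x : Circle2pi)) '' Ioc A B) (hFm : MeasurableSet F)
    (hv : volume.real F < (B - A) / 4 ^ n) :
    μ.real F ≤ γ ^ n * μ.real ((fun x : ℝ => (x : Circle2pi)) '' Ioc A B) := by
  have hsub : Ioc A B ⊆ Ioc A (A + 2 * Real.pi) := Ioc_subset_Ioc le_rfl hB
  set ν : Measure ℝ := μ.map (fun x : Circle2pi =>
    ((AddCircle.equivIoc (2 * Real.pi) A x : Ioc A (A + 2 * Real.pi)) : ℝ)) with hν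
  have hνE : ∀ E : Set ℝ, E ⊆ Ioc A B → MeasurableSet E →
      ν.real E = μ.real ((fun x : ℝ => (x : Circle2pi)) '' E) := by
    intro E hE hm
    rw [measureReal_def, measureReal_def, hν, Measure.map_apply (meas_f A) hm,
      preim_eq A E (hE.trans hsub)]
  have hfin : IsFiniteMeasure ν := by rw [hν]; infer_instance
  have hG : Good ν γ A B := by
    intro a b ha hab hb E hE hm hvE
    have h1 : Ioc a b ⊆ Ioc A B := Ioc_subset_Ioc ha hb
    rw [hνE E (hE.trans h1) hm, hνE _ h1 measurableSet_Ioc]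
    refine H _ _ ⟨a, b, hab, by linarith, rfl⟩ (image_mono hE) 
      (meas_im A E (hE.trans (h1.trans hsub)) hm) ?_
    rw [volr_arc a b hab (by linarith), measureReal_def,
      vol_im A E (hE.trans (h1.trans hsub)) hm]
    exact hvE
  have hmE : MeasurableSet ((fun x : ℝ => (x : Circle2pi)) ⁻¹' F ∩ Ioc A B) :=
    ((AddCircle.measurable_mk' (a := 2 * Real.pi)) hFm).inter measurableSet_Ioc
  have hFE : F = (fun x : ℝ => (x : Circle2pi)) '' ((fun x : ℝ => (x : Circle2pi)) ⁻¹' F ∩ Ioc A B) := by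
    rw [image_preimage_inter]
    exact (inter_eq_left.2 hF).symm
  have := real_main ν γ A B hG hγ hAB n _ inter_subset_right (by
    rw [hFE, measureReal_def, vol_im A _ (inter_subset_right.trans hsub) hmE] at hv
    exact hv)
  rw [hνE _ inter_subset_right hmE, hνE _ Subset.rfl measurableSet_Ioc, ← hFE] at this
  exact this

instance : NullSingletonClass (volume : Measure Circle2pi) := by
  refine ⟨fun x => ?_⟩
  obtain ⟨y, rfl⟩ := QuotientAddGroup.mk_surjective x
  have h := vol_im (y - Real.pi) {y} (by
    rw [singleton_subset_iff]; constructor <;> linarith [Real.pi_pos]) (measurableSet_singleton y)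
  rw [image_singleton, Real.volume_singleton] at h
  exact h

/-- A nontrivial connected subset of the circle is an arc up to two points. -/
theorem conn_arc (J : Set Circle2pi) (hJ : IsConnected J) (hnt : J.Nontrivial) :
    ∃ A B : ℝ, A < B ∧ B ≤ A + 2 * Real.pi ∧ ∃ N : Set Circle2pi, N.Finite ∧
      J ⊆ (fun x : ℝ => (x : Circle2pi)) '' Ioc A B ∪ N ∧
      (fun x : ℝ => (x : Circle2pi)) '' Ioc A B ⊆ J ∪ N := by
  by_cases hu : J = univ
  · refine ⟨0, 0 + 2 * Real.pi, by linarith [Real.pi_pos], le_rfl, ∅, finite_empty, ?_, ?_⟩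
    · rw [AddCircle.coe_image_Ioc_eq]; simp
    · rw [hu]; simp
  obtain ⟨p, hp⟩ := (ne_univ_iff_exists_notMem J).1 hu
  obtain ⟨c, rfl⟩ := QuotientAddGroup.mk_surjective p
  set e := AddCircle.openPartialHomeomorphCoe (2 * Real.pi) c with he
  have hJt : J ⊆ e.target := by
    intro x hx
    rw [he, AddCircle.openPartialHomeomorphCoe_target]
    rintro rfl
    exact hp hx
  set S := e.symm '' J with hS
  have hSc : IsConnected S := hJ.image _ (e.continuousOn_symm.mono hJt)
  have hSJ : (fun x : ℝ => (x : Circle2pi)) '' S = J := by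
    have := e.image_symm_image_of_subset_target hJt
    exact this
  have hSs : S ⊆ Ioo c (c + 2 * Real.pi) := by
    rintro _ ⟨x, hx, rfl⟩
    exact e.map_target (hJt hx)
  have hbb : BddBelow S := bddBelow_Ioo.mono hSs
  have hba : BddAbove S := bddAbove_Ioo.mono hSs
  have hne := hSc.nonempty
  have h1 := hSc.Ioo_csInf_csSup_subset hbb hba
  have h2 := subset_Icc_csInf_csSup hbb hba
  have hcA : c ≤ sInf S := le_csInf hne fun x hx => (hSs hx).1.le
  have hBc : sSup S ≤ c + 2 * Real.pi := csSup_le hne fun x hx => (hSs hx).2.le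
  have hSnt : S.Nontrivial := by
    by_contra hcon
    rw [not_nontrivial_iff] at hcon
    have := hcon.image (fun x : ℝ => (x : Circle2pi))
    rw [hSJ] at this
    exact not_nontrivial_iff.2 this hnt
  obtain ⟨x, hx, y, hy, hxy⟩ := hSnt.exists_lt
  have hAB : sInf S < sSup S := (h2 hx).1.trans_lt (hxy.trans_le (h2 hy).2)
  refine ⟨sInf S, sSup S, hAB, by linarith,
    {((sInf S : ℝ) : Circle2pi), ((sSup S : ℝ) : Circle2pi)}, by simp, ?_, ?_⟩
  · rw [← hSJ]
    rintro _ ⟨z, hz, rfl⟩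
    rcases (h2 hz).1.eq_or_lt with h | h
    · right; left; simp [h]
    · left; exact ⟨z, ⟨h, (h2 hz).2⟩, rfl⟩
  · rintro _ ⟨z, hz, rfl⟩
    rcases hz.2.eq_or_lt with h | h
    · right; right; simp [h]
    · left; rw [← hSJ]; exact ⟨z, h1 ⟨hz.1, h⟩, rfl⟩

/-- If `ψ` is a homeomorphism of the circle with `ψ⁻¹` absolutely continuous
and `|(ψ⁻¹)′| ∈ A∞`, then `|ψ′| ∈ A∞` as well: the inverse of a circle
homeomorphism whose derivative is an `A∞` weight also has derivative an `A∞`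
weight. -/
theorem inverse_homeomorphism_Ainfty
    (ψ : Circle2pi ≃ₜ Circle2pi)
    -- absolute continuity of ψ⁻¹
    (habs : ∀ E : Set Circle2pi, MeasurableSet E → volume E = 0 →
      volume (ψ.symm '' E) = 0)
    -- |(ψ⁻¹)′| ∈ A∞ :
    (hAinf : DerivAinfty ψ.symm) :
    DerivAinfty ψ := by
  obtain ⟨β₀, hβ₀, hA⟩ := hAinf
  set μ : Measure Circle2pi := Measure.map ψ volume with hμ
  have hμa : ∀ F, μ F = volume (ψ.symm '' F) := by
    intro F
    rw [hμ, ψ.measurableEmbedding.map_apply]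
    congr 1
    exact (ψ.symm.image_eq_preimage_symm F).symm
  have hfin : IsFiniteMeasure μ := by
    rw [hμ]; infer_instance
  have hμψ : ∀ E, μ (ψ '' E) = volume E := by
    intro E
    rw [hμa, ← image_comp]
    simp
  have hμna : NullSingletonClass μ := by
    refine ⟨fun x => ?_⟩
    rw [hμa, image_singleton]; exact measure_singleton _
  set β := min β₀ (1/2) with hβ
  have hβpos : 0 < β := lt_min hβ₀ (by norm_num)
  have hβle : β ≤ 1/2 := min_le_right _ _
  have hβle' : β ≤ β₀ := min_le_left _ _
  have H : ∀ K E : Set Circle2pi, IsArc K → E ⊆ K → MeasurableSet E →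
      volume.real E ≤ volume.real K / 2 → μ.real E ≤ (1 - β) * μ.real K := by
    intro K E hK hE hm hv
    have hKm : MeasurableSet K := by
      obtain ⟨a, b, hab, hb, rfl⟩ := hK
      exact meas_im a _ (Ioc_subset_Ioc le_rfl hb) measurableSet_Ioc
    have hKpos : 0 < volume.real K := by
      obtain ⟨a, b, hab, hb, rfl⟩ := hK
      rw [volr_arc a b hab hb]; linarith
    have h1 := hA K (K \ E) hK sdiff_subset (hKm.diff hm)
    rw [← hμa, ← hμa] at h1
    change μ.real (K \ E) / μ.real K < β₀ → volume.real (K \ E) / volume.real K < 1/2 at h1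
    have e1 := measureReal_sdiff_add_inter (μ := μ) (s := K) (t := E) hm
    have e2 := measureReal_sdiff_add_inter (μ := volume) (s := K) (t := E) hm
    rw [inter_eq_right.2 hE] at e1 e2
    rcases (measureReal_nonneg (μ := μ) (s := K)).eq_or_lt with h0 | h0
    · have := measureReal_mono (μ := μ) hE
      rw [← h0] at this ⊢
      linarith
    · rw [div_lt_iff₀ h0, div_lt_iff₀ hKpos] at h1
      by_contra hcon
      have := h1 (by nlinarith)
      linarith
  obtain ⟨n, hn⟩ := exists_pow_lt_of_lt_one (by norm_num : (0:ℝ) < 1/2) (by linarith : 1 - β < 1)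
  refine ⟨1 / 4 ^ n, by positivity, ?_⟩
  intro I E hI hE hm hlt
  change volume.real (ψ '' E) / volume.real (ψ '' I) < _ at hlt
  change volume.real E / volume.real I < _
  have hIpos : 0 < volume.real I := by
    obtain ⟨a, b, hab, hb, rfl⟩ := hI
    rw [volr_arc a b hab hb]; linarith
  have hIc : IsConnected I := by
    obtain ⟨a, b, hab, hb, rfl⟩ := hI
    exact (isConnected_Ioc hab).image _ (AddCircle.continuous_mk' _).continuousOn
  have hInt : I.Nontrivial := by
    by_contra hcon
    rw [not_nontrivial_iff] at hcon
    have : volume I = 0 := hcon.measure_zero _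
    rw [measureReal_def, this] at hIpos
    simp at hIpos
  obtain ⟨A, B, hAB, hB, N, hN, hJ1, hJ2⟩ := conn_arc (ψ '' I)
    (hIc.image _ ψ.continuous.continuousOn) (hInt.image ψ.injective)
  set J' := (fun x : ℝ => (x : Circle2pi)) '' Ioc A B with hJ'
  have hle : ∀ (m : Measure Circle2pi) [IsFiniteMeasure m] [NullSingletonClass m] (P Q : Set Circle2pi),
      P ⊆ Q ∪ N → m.real P ≤ m.real Q := by
    intro m _ _ P Q hPQ
    have h1 := measureReal_mono (μ := m) hPQ
    have h2 := measureReal_union_le (μ := m) Q N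
    have h3 : m.real N = 0 := by rw [measureReal_def, hN.measure_zero]; simp
    linarith
  have hJv : volume.real (ψ '' I) = B - A := by
    rw [← volr_arc A B hAB hB]
    exact le_antisymm (hle volume _ _ hJ1) (hle volume _ _ hJ2)
  have hJ'm : MeasurableSet J' := meas_im A _ (Ioc_subset_Ioc le_rfl hB) measurableSet_Ioc
  have hFm : MeasurableSet (ψ '' E) := ψ.measurableEmbedding.measurableSet_image.2 hm
  rw [hJv, div_lt_iff₀ (by linarith)] at hlt
  have key := circle_main μ (1 - β) (by linarith) H A B hAB hB n (ψ '' E ∩ J') inter_subset_right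
    (hFm.inter hJ'm) (by
      have := measureReal_mono (μ := (volume : Measure Circle2pi)) (inter_subset_left (s := ψ '' E) (t := J'))
      have e : (B - A) / 4 ^ n = 1 / 4 ^ n * (B - A) := by ring
      linarith)
  have k1 : μ.real (ψ '' E) ≤ μ.real (ψ '' E ∩ J') := by
    apply hle
    intro x hx
    rcases hJ1 (image_mono hE hx) with h | h
    · left; exact ⟨hx, h⟩
    · right; exact h
  have k2 : μ.real J' ≤ μ.real (ψ '' I) := hle μ _ _ hJ2
  have r1 : μ.real (ψ '' E) = volume.real E := by rw [measureReal_def, hμψ]; rfl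
  have r2 : μ.real (ψ '' I) = volume.real I := by rw [measureReal_def, hμψ]; rfl
  rw [div_lt_iff₀ hIpos]
  rw [r1] at k1
  rw [r2] at k2
  have hp : 0 ≤ (1 - β) ^ n := pow_nonneg (by linarith) n
  calc volume.real E ≤ (1 - β) ^ n * μ.real J' := k1.trans key
    _ ≤ (1 - β) ^ n * volume.real I := by gcongr
    _ < 1 / 2 * volume.real I := by gcongr
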